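/- Let (G,c) be a colored DAG on V = {1,…,p} and Σ a positive definite V×V matrix. Then Σ ∈ M(G,c) if and only if Σ satisfies the local Markov property with respect to (G,c), i.e., all of the following hold: (1) for every i ∈ V, the submatrix Σ_{{i}∪pa_G(i), N_i∪pa_G(i)} has rank |pa_G(i)|, where N_i = (V ∖ de̅_G(i)) ∖ pa_G(i) is the set of nondescendants of i that are not parents of i; (2) ω_{i|pa_G(i)}(Σ) = ω_{j|pa_G(j)}(Σ) for every pair of vertices i, j with c(i) = c(j); (3) λ_{ij|pa_G(j)}(Σ) = λ_{kℓ|pa_G(ℓ)}(Σ) for every pair of edges ij, kℓ ∈ E with c(ij) = c(kℓ). -/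

import Mathlib

open Matrix

/-- Principal minor `|Σ_A|`: determinant of the submatrix with rows and columns `A`. -/
noncomputable def pminor {p : ℕ} {R : Type*} [CommRing R] (M : Matrix (Fin p) (Fin p) R)
    (A : Finset (Fin p)) : R :=
  (M.submatrix (fun a : {x // x ∈ A} => a.1) (fun a : {x // x ∈ A} => a.1)).det

/-- Almost-principal minor `|Σ_{ij|K}| = |Σ_{{i}∪K, {j}∪K}|`: determinant of the submatrix
with rows `{i} ∪ K` and columns `{j} ∪ K`, where `i` is matched with `j` and the elements
of `K` are matched with themselves. -/
noncomputable def cminor {p : ℕ} {R : Type*} [CommRing R] (M : Matrix (Fin p) (Fin p) R)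
    (i j : Fin p) (K : Finset (Fin p)) : R :=
  (M.submatrix (Sum.elim (fun _ : Unit => i) (fun k : {x // x ∈ K} => k.1))
               (Sum.elim (fun _ : Unit => j) (fun k : {x // x ∈ K} => k.1))).det

/-- The parametrization `φ_G(Ω,Λ) = (1-Λ)^{-T} Ω (1-Λ)⁻¹` of a Gaussian DAG model. -/
noncomputable def phiG {p : ℕ} (W L : Matrix (Fin p) (Fin p) ℝ) : Matrix (Fin p) (Fin p) ℝ :=
  ((1 - L)⁻¹)ᵀ * W * (1 - L)⁻¹

/-- The parents `pa_G(j) = {k : (k,j) ∈ E}` of a vertex `j` in the DAG with edge set `E`. -/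
def parents {p : ℕ} (E : Finset (Fin p × Fin p)) (j : Fin p) : Finset (Fin p) :=
  Finset.univ.filter (fun k => (k, j) ∈ E)

/-- A directed graph with edge set `E` is acyclic iff no vertex lies on a directed cycle. -/
def IsAcyclic {p : ℕ} (E : Finset (Fin p × Fin p)) : Prop :=
  ∀ i : Fin p, ¬ Relation.TransGen (fun a b => (a, b) ∈ E) i i

/-- `j` lies in `de̅_G(i) = {i} ∪ de_G(i)`, the closure of the descendants of `i`. -/
def InDescClosure {p : ℕ} (E : Finset (Fin p × Fin p)) (i j : Fin p) : Prop :=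
  j = i ∨ Relation.TransGen (fun a b => (a, b) ∈ E) i j

/-- The colored Gaussian DAG model `M(G,c)`: covariance matrices `φ_G(Ω,Λ)` where
`Ω = diag(ω)` has positive diagonal with `ω_i = ω_j` whenever `c(i) = c(j)`,
and `Λ` is supported on `E` with `λ_{ij} = λ_{kℓ}` whenever `c(ij) = c(kℓ)`. -/
noncomputable def coloredModel {p : ℕ} (E : Finset (Fin p × Fin p))
    (cV : Fin p → ℕ) (cE : Fin p × Fin p → ℕ) : Set (Matrix (Fin p) (Fin p) ℝ) :=
  {S | ∃ (ω : Fin p → ℝ) (L : Matrix (Fin p) (Fin p) ℝ),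
    (∀ v, 0 < ω v) ∧ (∀ a b, (a, b) ∉ E → L a b = 0) ∧
    (∀ a b, cV a = cV b → ω a = ω b) ∧
    (∀ e ∈ E, ∀ e' ∈ E, cE e = cE e' → L e.1 e.2 = L e'.1 e'.2) ∧
    S = phiG (Matrix.diagonal ω) L}

open scoped Classical in
/-- The set `N_i = (V ∖ de̅_G(i)) ∖ pa_G(i)` of nondescendants of `i` that are not
parents of `i`. -/
noncomputable def ndnp {p : ℕ} (E : Finset (Fin p × Fin p)) (i : Fin p) : Finset (Fin p) :=
  Finset.univ.filter fun j => ¬ InDescClosure E i j ∧ j ∉ parents E i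

section Minors

variable {p : ℕ} {R : Type*} [CommRing R] (M : Matrix (Fin p) (Fin p) R)

theorem pminor_insert {j : Fin p} {A : Finset (Fin p)} (hj : j ∉ A) :
    pminor M (insert j A) = cminor M j j A := by
  let f : Unit ⊕ {x // x ∈ A} → {x // x ∈ insert j A} :=
    Sum.elim (fun _ => ⟨j, Finset.mem_insert_self j A⟩)
      (fun k => ⟨k.1, Finset.mem_insert_of_mem k.2⟩)
  have hf : Function.Bijective f := by
    constructor
    · rintro (_ | ⟨a, ha⟩) (_ | ⟨b, hb⟩) h
      · rfl
      · obtain rfl : j = b := congrArg Subtype.val h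
        exact absurd hb hj
      · obtain rfl : a = j := congrArg Subtype.val h
        exact absurd ha hj
      · simpa [f] using h
    · rintro ⟨x, hx⟩
      rcases Finset.mem_insert.1 hx with rfl | h
      · exact ⟨Sum.inl (), rfl⟩
      · exact ⟨Sum.inr ⟨x, h⟩, rfl⟩
  rw [pminor, cminor, ← Matrix.det_submatrix_equiv_self (Equiv.ofBijective f hf),
    Matrix.submatrix_submatrix]
  congr 2 <;> funext x <;> rcases x with x | x <;> rfl

/-- Expanding column `j` of an almost-principal minor along the columns in `K`, up to a
remainder in column `i'` and a remainder in row `i`. -/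
theorem cminor_eq_mul_of_column {i i' j : Fin p} {K : Finset (Fin p)} {a : R} {c : Fin p → R}
    (hi : M i j = M i i' * a + ∑ k ∈ K, M i k * c k)
    (hK : ∀ v ∈ K, M v j = M v i' * a + ∑ k ∈ K, M v k * c k) :
    cminor M i j K = cminor M i i' K * a := by
  have key : M.submatrix (Sum.elim (fun _ : Unit => i) (fun k : {x // x ∈ K} => k.1))
        (Sum.elim (fun _ : Unit => j) (fun k : {x // x ∈ K} => k.1)) =
      M.submatrix (Sum.elim (fun _ : Unit => i) (fun k : {x // x ∈ K} => k.1))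
        (Sum.elim (fun _ : Unit => i') (fun k : {x // x ∈ K} => k.1)) *
      fromBlocks (Matrix.of fun _ _ => a) 0 (Matrix.of fun k _ => c k.1) 1 := by
    ext x y
    rw [Matrix.mul_apply, Fintype.sum_sum_type]
    rcases y with y | y
    · rcases x with x | ⟨x, hx⟩
      · simp only [submatrix_apply, Sum.elim_inl, Sum.elim_inr, fromBlocks_apply₁₁,
          fromBlocks_apply₂₁, of_apply, Finset.univ_unique, Finset.sum_singleton, hi]
        rw [Finset.sum_coe_sort K (fun k => M i k * c k)]
      · simp only [submatrix_apply, Sum.elim_inl, Sum.elim_inr, fromBlocks_apply₁₁,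
          fromBlocks_apply₂₁, of_apply, Finset.univ_unique, Finset.sum_singleton, hK x hx]
        rw [Finset.sum_coe_sort K (fun k => M x k * c k)]
    · simp [Matrix.one_apply]
  rw [cminor, key, Matrix.det_mul, Matrix.det_fromBlocks_zero₁₂]
  simp [cminor]

theorem cminor_erase_eq_of_regression {i j : Fin p} {A : Finset (Fin p)} {c : Fin p → R}
    (hiA : i ∈ A) (h : ∀ v ∈ A, M v j = ∑ k ∈ A, M v k * c k) :
    cminor M i j (A.erase i) = c i * pminor M A := by
  have h' : ∀ v ∈ A, M v j = M v i * c i + ∑ k ∈ A.erase i, M v k * c k := fun v hv => by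
    rw [h v hv, Finset.add_sum_erase A (fun k => M v k * c k) hiA]
  rw [cminor_eq_mul_of_column M (h' i hiA) fun v hv => h' v (Finset.mem_of_mem_erase hv),
    ← pminor_insert M (Finset.notMem_erase i A), Finset.insert_erase hiA, mul_comm]

theorem pminor_insert_eq_of_regression {j : Fin p} {A : Finset (Fin p)} {c : Fin p → R}
    (hj : j ∉ A) (h : ∀ v ∈ A, M v j = ∑ k ∈ A, M v k * c k) :
    pminor M (insert j A) = (M j j - ∑ k ∈ A, M j k * c k) * pminor M A := by
  have key : M.submatrix (Sum.elim (fun _ : Unit => j) (fun k : {x // x ∈ A} => k.1))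
        (Sum.elim (fun _ : Unit => j) (fun k : {x // x ∈ A} => k.1)) =
      fromBlocks (Matrix.of fun _ _ => M j j - ∑ k ∈ A, M j k * c k)
        (Matrix.of fun _ k => M j k.1) 0
        (M.submatrix (fun a : {x // x ∈ A} => a.1) (fun a : {x // x ∈ A} => a.1)) *
      fromBlocks (1 : Matrix Unit Unit R) 0 (Matrix.of fun k _ => c k.1) 1 := by
    rw [fromBlocks_multiply]
    ext x y
    rcases y with y | y
    · rcases x with x | ⟨x, hx⟩
      · simp [Matrix.mul_apply, Finset.sum_attach A (fun k => M j k * c k)]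
      · simp [Matrix.mul_apply, Finset.sum_attach A (fun k => M x k * c k), h x hx]
    · rcases x with x | x <;> simp
  rw [pminor_insert M hj, cminor, key, Matrix.det_mul, Matrix.det_fromBlocks_zero₁₂,
    Matrix.det_fromBlocks_zero₂₁]
  simp [pminor]

end Minors

theorem pminor_pos {p : ℕ} {S : Matrix (Fin p) (Fin p) ℝ} (hS : S.PosDef)
    (A : Finset (Fin p)) : 0 < pminor S A :=
  (hS.submatrix Subtype.val_injective).det_pos

/-- For positive definite `S` and `A ⊆ C`, the rows of `S` indexed by `A ∪ {j}`, restricted to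
the columns in `C`, have rank `|A|` iff row `j` is a combination of the rows in `A`. -/
theorem rank_submatrix_insert_eq_card_iff {p : ℕ} {S : Matrix (Fin p) (Fin p) ℝ}
    (hS : S.PosDef) (j : Fin p) {A C : Finset (Fin p)} (hAC : A ⊆ C) :
    (S.submatrix (fun a : {x // x ∈ insert j A} => a.1)
        (fun b : {x // x ∈ C} => b.1)).rank = A.card ↔
      ∃ c : Fin p → ℝ, ∀ v ∈ C, S v j = ∑ k ∈ A, S v k * c k := by
  have hsymm : ∀ a b, S a b = S b a := fun a b => by simpa using (hS.isHermitian.apply a b).symm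
  set r : Fin p → {x // x ∈ C} → ℝ := fun a b => S a b.1 with hr
  have hli : LinearIndependent ℝ (fun a : {x // x ∈ A} => r a.1) := by
    have h := Matrix.linearIndependent_rows_of_isUnit
      (hS.submatrix (e := fun a : {x // x ∈ A} => a.1) Subtype.val_injective).isUnit
    exact LinearIndependent.of_comp
      (LinearMap.funLeft ℝ ℝ (fun a : {x // x ∈ A} => (⟨a.1, hAC a.2⟩ : {x // x ∈ C}))) h
  have hcard : Module.finrank ℝ (Submodule.span ℝ (r '' A)) = A.card := by
    have h := finrank_span_eq_card hli
    rw [Fintype.card_coe] at h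
    rw [← h, Set.image_eq_range]
    rfl
  have hrank : (S.submatrix (fun a : {x // x ∈ insert j A} => a.1)
      (fun b : {x // x ∈ C} => b.1)).rank =
        Module.finrank ℝ (Submodule.span ℝ (insert (r j) (r '' A))) := by
    rw [Matrix.rank_eq_finrank_span_row, ← Set.image_insert_eq, ← Finset.coe_insert,
      Set.image_eq_range]
    rfl
  have hmem : r j ∈ Submodule.span ℝ (r '' A) ↔
      ∃ c : Fin p → ℝ, ∀ v ∈ C, S v j = ∑ k ∈ A, S v k * c k := by
    rw [Submodule.mem_span_image_finset_iff_exists_fun']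
    refine exists_congr fun c => ?_
    rw [funext_iff, Subtype.forall]
    refine forall₂_congr fun v hv => ?_
    simp only [hr, Finset.sum_apply, Pi.smul_apply, smul_eq_mul]
    rw [eq_comm, hsymm j v]
    simp only [hsymm _ v, mul_comm]
  rw [hrank, ← hmem]
  constructor
  · intro h
    have heq := Submodule.eq_of_le_of_finrank_eq
      (Submodule.span_mono (R := ℝ) (Set.subset_insert (r j) (r '' A))) (hcard.trans h.symm)
    rw [heq]
    exact Submodule.subset_span (Set.mem_insert _ _)
  · intro h
    rw [Submodule.span_insert_eq_span h, hcard]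

section Graph

variable {p : ℕ} {E : Finset (Fin p × Fin p)}

theorem mem_parents {j k : Fin p} : k ∈ parents E j ↔ (k, j) ∈ E := by
  simp [parents]

theorem IsAcyclic.notMem_parents (hE : IsAcyclic E) (j : Fin p) : j ∉ parents E j :=
  fun h => hE j (.single (mem_parents.1 h))

theorem IsAcyclic.not_inDescClosure_of_mem_parents (hE : IsAcyclic E) {j k : Fin p}
    (h : k ∈ parents E j) : ¬ InDescClosure E j k := by
  rintro (rfl | h')
  · exact hE.notMem_parents _ h
  · exact hE j (h'.tail (mem_parents.1 h))

theorem IsAcyclic.mem_ndnp_union_parents (hE : IsAcyclic E) {j v : Fin p} :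
    v ∈ ndnp E j ∪ parents E j ↔ ¬ InDescClosure E j v := by
  by_cases h : v ∈ parents E j
  · simp [h, hE.not_inDescClosure_of_mem_parents h]
  · simp [h, ndnp]

theorem InDescClosure.of_edge {a b v : Fin p} (h : (a, b) ∈ E) (hv : InDescClosure E b v) :
    InDescClosure E a v := by
  rcases hv with rfl | hv
  · exact .inr (.single h)
  · exact .inr (.head h hv)

/-- Induction on the vertices of a DAG, starting from the sinks. -/
theorem IsAcyclic.child_induction (hE : IsAcyclic E) {P : Fin p → Prop}
    (h : ∀ a, (∀ b, (a, b) ∈ E → P b) → P a) (a : Fin p) : P a := by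
  let r : Fin p → Fin p → Prop := fun b a => Relation.TransGen (fun a b => (a, b) ∈ E) a b
  have : IsTrans (Fin p) r := ⟨fun _ _ _ h₁ h₂ => Relation.TransGen.trans h₂ h₁⟩
  have : Std.Irrefl r := ⟨hE⟩
  exact (Finite.wellFounded_of_trans_of_irrefl r).induction a
    fun a ih => h a fun b hb => ih b (.single hb)

variable {L : Matrix (Fin p) (Fin p) ℝ}

theorem IsAcyclic.isUnit_one_sub_det (hE : IsAcyclic E) (hL : ∀ a b, (a, b) ∉ E → L a b = 0) :
    IsUnit (1 - L).det := by
  rw [isUnit_iff_ne_zero]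
  intro h
  obtain ⟨x, hx, hLx⟩ := Matrix.exists_mulVec_eq_zero_iff.2 h
  refine hx (funext fun a => hE.child_induction (P := fun a => x a = 0) (fun a ih => ?_) a)
  have ha := congrFun hLx a
  rw [Matrix.sub_mulVec, Matrix.one_mulVec, Pi.sub_apply, Pi.zero_apply, sub_eq_zero] at ha
  rw [ha, Matrix.mulVec, dotProduct]
  refine Finset.sum_eq_zero fun b _ => ?_
  by_cases hab : (a, b) ∈ E
  · rw [ih b hab, mul_zero]
  · rw [hL a b hab, zero_mul]

theorem IsAcyclic.inv_one_sub_apply (hE : IsAcyclic E) (hL : ∀ a b, (a, b) ∉ E → L a b = 0)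
    (a v : Fin p) :
    (1 - L)⁻¹ a v = (1 : Matrix (Fin p) (Fin p) ℝ) a v + ∑ b, L a b * (1 - L)⁻¹ b v := by
  have h := congrFun₂ (Matrix.mul_nonsing_inv _ (hE.isUnit_one_sub_det hL)) a v
  rw [Matrix.sub_mul, Matrix.one_mul, Matrix.sub_apply, Matrix.mul_apply] at h
  linarith

theorem IsAcyclic.inv_one_sub_eq_zero (hE : IsAcyclic E) (hL : ∀ a b, (a, b) ∉ E → L a b = 0)
    {a v : Fin p} (hv : ¬ InDescClosure E a v) : (1 - L)⁻¹ a v = 0 := by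
  revert hv
  refine hE.child_induction (P := fun a => ¬ InDescClosure E a v → (1 - L)⁻¹ a v = 0)
    (fun a ih hv => ?_) a
  rw [hE.inv_one_sub_apply hL, Matrix.one_apply_ne (fun h => hv (.inl h.symm)), zero_add]
  refine Finset.sum_eq_zero fun b _ => ?_
  by_cases hab : (a, b) ∈ E
  · rw [ih b hab fun h => hv (h.of_edge hab), mul_zero]
  · rw [hL a b hab, zero_mul]

theorem IsAcyclic.inv_one_sub_diag (hE : IsAcyclic E) (hL : ∀ a b, (a, b) ∉ E → L a b = 0)
    (a : Fin p) : (1 - L)⁻¹ a a = 1 := by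
  rw [hE.inv_one_sub_apply hL, Matrix.one_apply_eq, add_eq_left]
  refine Finset.sum_eq_zero fun b _ => ?_
  by_cases hab : (a, b) ∈ E
  · rw [hE.inv_one_sub_eq_zero hL (hE.not_inDescClosure_of_mem_parents (mem_parents.2 hab)),
      mul_zero]
  · rw [hL a b hab, zero_mul]

theorem sum_mul_eq_sum_parents (hL : ∀ a b, (a, b) ∉ E → L a b = 0) (f : Fin p → ℝ)
    (j : Fin p) : ∑ k, f k * L k j = ∑ k ∈ parents E j, f k * L k j := by
  refine (Finset.sum_subset (Finset.subset_univ _) fun k _ hk => ?_).symm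
  rw [hL k j fun h => hk (mem_parents.2 h), mul_zero]

theorem mul_one_sub_apply (hL : ∀ a b, (a, b) ∉ E → L a b = 0) (S : Matrix (Fin p) (Fin p) ℝ)
    (v j : Fin p) : (S * (1 - L)) v j = S v j - ∑ k ∈ parents E j, S v k * L k j := by
  rw [Matrix.mul_sub, Matrix.mul_one, Matrix.sub_apply, Matrix.mul_apply,
    sum_mul_eq_sum_parents hL]

theorem IsAcyclic.phiG_mul_one_sub_apply (hE : IsAcyclic E)
    (hL : ∀ a b, (a, b) ∉ E → L a b = 0) (ω : Fin p → ℝ) (v j : Fin p) :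
    (phiG (Matrix.diagonal ω) L * (1 - L)) v j = (1 - L)⁻¹ j v * ω j := by
  rw [phiG, Matrix.mul_assoc, Matrix.nonsing_inv_mul _ (hE.isUnit_one_sub_det hL),
    Matrix.mul_one, Matrix.mul_diagonal, Matrix.transpose_apply]

/-- `S = φ_G(Ω, Λ)` iff column `j` of `Λ` holds the coefficients of the regression of `j` on its
parents, on all nondescendants of `j`, and `ω_j` is the residual variance. -/
theorem IsAcyclic.eq_phiG_diagonal_iff (hE : IsAcyclic E)
    (hL : ∀ a b, (a, b) ∉ E → L a b = 0) {S : Matrix (Fin p) (Fin p) ℝ} (hS : S.IsSymm)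
    (ω : Fin p → ℝ) :
    S = phiG (Matrix.diagonal ω) L ↔
      (∀ j v, ¬ InDescClosure E j v → S v j = ∑ k ∈ parents E j, S v k * L k j) ∧
      ∀ j, ω j = S j j - ∑ k ∈ parents E j, S j k * L k j := by
  have hU := hE.isUnit_one_sub_det hL
  constructor
  · intro h
    have h' : ∀ v j, S v j - ∑ k ∈ parents E j, S v k * L k j = (1 - L)⁻¹ j v * ω j := by
      intro v j
      rw [← mul_one_sub_apply hL, h, hE.phiG_mul_one_sub_apply hL]
    refine ⟨fun j v hv => ?_, fun j => ?_⟩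
    · rw [← sub_eq_zero, h', hE.inv_one_sub_eq_zero hL hv, zero_mul]
    · rw [h', hE.inv_one_sub_diag hL, one_mul]
  · rintro ⟨hreg, hω⟩
    have hM : ∀ j v, ¬ InDescClosure E j v → (S * (1 - L)) v j = 0 := fun j v hv => by
      rw [mul_one_sub_apply hL, sub_eq_zero, hreg j v hv]
    have hWapply : ∀ u j : Fin p, ((1 - L)ᵀ * (S * (1 - L)) : Matrix (Fin p) (Fin p) ℝ) u j =
        (S * (1 - L)) u j - ∑ k ∈ parents E u, (S * (1 - L)) k j * L k u := fun u j => by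
      rw [Matrix.transpose_sub, Matrix.transpose_one, Matrix.sub_mul, Matrix.one_mul,
        Matrix.sub_apply, Matrix.mul_apply (M := Lᵀ), ← sum_mul_eq_sum_parents hL]
      simp only [Matrix.transpose_apply, mul_comm]
    have hWsymm : ((1 - L)ᵀ * (S * (1 - L))).IsSymm := by
      rw [Matrix.IsSymm, Matrix.transpose_mul, Matrix.transpose_mul, Matrix.transpose_transpose,
        hS.eq, Matrix.mul_assoc]
    have hzero : ∀ u j : Fin p, ¬ InDescClosure E j u →
        ((1 - L)ᵀ * (S * (1 - L)) : Matrix (Fin p) (Fin p) ℝ) u j = 0 := by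
      intro u j hu
      rw [hWapply, hM j u hu, zero_sub, neg_eq_zero]
      refine Finset.sum_eq_zero fun k hk => ?_
      rw [hM j k, zero_mul]
      rintro (rfl | h)
      · exact hu (.inr (.single (mem_parents.1 hk)))
      · exact hu (.inr (h.tail (mem_parents.1 hk)))
    have hW : (1 - L)ᵀ * (S * (1 - L)) = Matrix.diagonal ω := by
      ext u j
      by_cases huj : u = j
      · subst huj
        rw [hWapply, Matrix.diagonal_apply_eq, hω, mul_one_sub_apply hL, sub_eq_self]
        refine Finset.sum_eq_zero fun k hk => ?_
        rw [hM u k (hE.not_inDescClosure_of_mem_parents hk), zero_mul]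
      · rw [Matrix.diagonal_apply_ne _ huj]
        by_cases hu : InDescClosure E j u
        · rw [← hWsymm.apply]
          refine hzero j u fun hj => ?_
          rcases hu with hu | hu
          · exact huj hu
          · rcases hj with hj | hj
            · exact huj hj.symm
            · exact hE u (hj.trans hu)
        · exact hzero u j hu
    have hUt : IsUnit ((1 - L)ᵀ).det := by rwa [Matrix.det_transpose]
    rw [phiG, ← hW, Matrix.transpose_nonsing_inv, Matrix.nonsing_inv_mul_cancel_left _ _ hUt,
      Matrix.mul_nonsing_inv_cancel_right _ _ hU]

end Graph

/-- Local Markov property characterizes the colored model.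
For a colored DAG `(G,c)` and a positive definite `Σ`, one has `Σ ∈ M(G,c)` iff
(1) for each `i`, the submatrix `Σ_{{i}∪pa(i), N_i∪pa(i)}` has rank `|pa(i)|`;
(2) `ω_{i|pa(i)}(Σ) = ω_{j|pa(j)}(Σ)` whenever `c(i) = c(j)`; and
(3) `λ_{ij|pa(j)}(Σ) = λ_{kℓ|pa(ℓ)}(Σ)` whenever `ij, kℓ ∈ E` with `c(ij) = c(kℓ)`. -/
theorem local_markov_characterization {p : ℕ} (E : Finset (Fin p × Fin p))
    (hE : IsAcyclic E) (cV : Fin p → ℕ) (cE : Fin p × Fin p → ℕ)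
    (S : Matrix (Fin p) (Fin p) ℝ) (hposdef : S.PosDef) :
    S ∈ coloredModel E cV cE ↔
      ((∀ i : Fin p,
          (S.submatrix
            (fun a : {x // x ∈ insert i (parents E i)} => a.1)
            (fun b : {x // x ∈ ndnp E i ∪ parents E i} => b.1)).rank
            = (parents E i).card) ∧
       (∀ i j : Fin p, cV i = cV j →
          pminor S (insert i (parents E i)) / pminor S (parents E i)
            = pminor S (insert j (parents E j)) / pminor S (parents E j)) ∧
       (∀ e ∈ E, ∀ e' ∈ E, cE e = cE e' →
          cminor S e.1 e.2 ((parents E e.2).erase e.1) / pminor S (parents E e.2)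
            = cminor S e'.1 e'.2 ((parents E e'.2).erase e'.1) / pminor S (parents E e'.2))) := by
  have hsymm : S.IsSymm := by simpa [Matrix.IsHermitian, Matrix.IsSymm] using hposdef.isHermitian
  have hω {L : Matrix (Fin p) (Fin p) ℝ}
      (hreg : ∀ j v, ¬ InDescClosure E j v → S v j = ∑ k ∈ parents E j, S v k * L k j)
      (j : Fin p) : pminor S (insert j (parents E j)) / pminor S (parents E j)
        = S j j - ∑ k ∈ parents E j, S j k * L k j := by
    rw [div_eq_iff (pminor_pos hposdef _).ne']
    exact pminor_insert_eq_of_regression S (hE.notMem_parents j)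
      fun v hv => hreg j v (hE.not_inDescClosure_of_mem_parents hv)
  have hl {L : Matrix (Fin p) (Fin p) ℝ}
      (hreg : ∀ j v, ¬ InDescClosure E j v → S v j = ∑ k ∈ parents E j, S v k * L k j)
      {e : Fin p × Fin p} (he : e ∈ E) :
      cminor S e.1 e.2 ((parents E e.2).erase e.1) / pminor S (parents E e.2) = L e.1 e.2 := by
    rw [div_eq_iff (pminor_pos hposdef _).ne']
    exact cminor_erase_eq_of_regression S (c := fun k => L k e.2) (mem_parents.2 he)
      fun v hv => hreg _ v (hE.not_inDescClosure_of_mem_parents hv)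
  constructor
  · rintro ⟨ω, L, -, hL, hcV, hcE, hphi⟩
    obtain ⟨hreg, hres⟩ := (hE.eq_phiG_diagonal_iff hL hsymm ω).1 hphi
    refine ⟨fun j => ?_, fun i j hij => ?_, fun e he e' he' hee' => ?_⟩
    · rw [rank_submatrix_insert_eq_card_iff hposdef j Finset.subset_union_right]
      exact ⟨fun k => L k j, fun v hv => hreg j v (hE.mem_ndnp_union_parents.1 hv)⟩
    · rw [hω hreg, hω hreg, ← hres, ← hres, hcV i j hij]
    · rw [hl hreg he, hl hreg he', hcE e he e' he' hee']
  · rintro ⟨hrank, hV, hEdge⟩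
    choose c hc using fun j =>
      (rank_submatrix_insert_eq_card_iff hposdef j Finset.subset_union_right).1 (hrank j)
    let L : Matrix (Fin p) (Fin p) ℝ := Matrix.of fun k j => if (k, j) ∈ E then c j k else 0
    have hL : ∀ a b, (a, b) ∉ E → L a b = 0 := fun a b h => if_neg h
    have hreg : ∀ j v, ¬ InDescClosure E j v →
        S v j = ∑ k ∈ parents E j, S v k * L k j := fun j v hv => by
      rw [hc j v (hE.mem_ndnp_union_parents.2 hv)]
      refine Finset.sum_congr rfl fun k hk => ?_
      rw [show L k j = c j k from if_pos (mem_parents.1 hk)]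
    refine ⟨fun j => pminor S (insert j (parents E j)) / pminor S (parents E j), L,
      fun j => div_pos (pminor_pos hposdef _) (pminor_pos hposdef _), hL, hV,
      fun e he e' he' hee' => ?_, (hE.eq_phiG_diagonal_iff hL hsymm _).2 ⟨hreg, hω hreg⟩⟩
    rw [← hl hreg he, ← hl hreg he', hEdge e he e' he' hee']
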